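/- arXiv:1912.04885 — 5 statements merged into one kernel-verified Lean document; each statement's English description precedes it below -/
import Mathlib

section
/- Let Φ be a finite set, L ≥ 1 an integer, and Φ = A_1 ⊇ A_2 ⊇ … ⊇ A_L a descending chain of subsets of Φ. Let p_1 ≥ p_2 ≥ … ≥ p_L ≥ 0 be integers with p_1 ≤ |Φ|. Then there exists a function r : Φ → {0,1} such that Σ_{i ∈ Φ} r_i = |Φ| − p_1 and, for every l ∈ {1,…,L}, Σ_{i ∈ A_l} (1 − r_i) ≥ min(p_l, |A_l|). -/
/-- In an antitone finite sequence of finsets whose first member has at least `n` elements,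
one can choose `n` elements of the first member so that the chosen set is comparable
with every member of the sequence. -/
theorem exists_card_eq_forall_subset_or_subset {α : Type*} [DecidableEq α] {L : ℕ} (hL : 1 ≤ L)
    (A : Fin L → Finset α) (hA : Antitone A) {n : ℕ} (hn : n ≤ (A ⟨0, hL⟩).card) :
    ∃ S ⊆ A ⟨0, hL⟩, S.card = n ∧ ∀ l, A l ⊆ S ∨ S ⊆ A l := by
  obtain ⟨m, hm, hmax⟩ := Finset.exists_max_image
    (Finset.univ.filter fun l => n ≤ (A l).card) id ⟨⟨0, hL⟩, by simpa using hn⟩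
  simp only [Finset.mem_filter, Finset.mem_univ, true_and, id] at hm hmax
  have hsub : A m ⊆ A ⟨0, hL⟩ := hA (Fin.mk_le_of_le_val (Nat.zero_le _))
  obtain ⟨B, hBm, hBn, hB⟩ :
      ∃ B ⊆ A m, B.card ≤ n ∧ ∀ l, (A l).card < n → A l ⊆ B := by
    by_cases hne : (Finset.univ.filter fun l => (A l).card < n).Nonempty
    · obtain ⟨k, hk, hmin⟩ := Finset.exists_min_image _ id hne
      simp only [Finset.mem_filter, Finset.mem_univ, true_and, id] at hk hmin
      refine ⟨A k, ?_, hk.le, fun l hl => hA (hmin l hl)⟩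
      rcases le_total m k with h | h
      · exact hA h
      · exact absurd (hm.trans (Finset.card_le_card (hA h))) hk.not_ge
    · refine ⟨∅, Finset.empty_subset _, by simp, fun l hl => (hne ⟨l, ?_⟩).elim⟩
      simpa using hl
  obtain ⟨S, hBS, hSm, hS⟩ := Finset.exists_subsuperset_card_eq hBm hBn hm
  refine ⟨S, hSm.trans hsub, hS, fun l => ?_⟩
  rcases lt_or_ge (A l).card n with h | h
  · exact Or.inl ((hB l h).trans hBS)
  · exact Or.inr (hSm.trans (hA (hmax l h)))

/-- Given a finite set `Φ`, a descending chain `Φ = A 0 ⊇ A 1 ⊇ …`,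
and a decreasing sequence of integers `p 0 ≥ p 1 ≥ … ≥ 0` with `p 0 ≤ |Φ|`,
there is `r : Φ → {0,1}` with `Σ_{i ∈ Φ} r i = |Φ| − p 0` and
`Σ_{i ∈ A l} (1 − r i) ≥ min (p l) |A l|` for all `l`. -/
theorem stmt_3 {α : Type*} [DecidableEq α] (Φ : Finset α) (L : ℕ) (hL : 1 ≤ L)
    (A : Fin L → Finset α) (hA0 : A ⟨0, hL⟩ = Φ)
    (hchain : ∀ k l : Fin L, k ≤ l → A l ⊆ A k)
    (p : Fin L → ℕ) (hp : ∀ k l : Fin L, k ≤ l → p l ≤ p k)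
    (hp1 : p ⟨0, hL⟩ ≤ Φ.card) :
    ∃ r : α → ℕ, (∀ i, r i ≤ 1) ∧ (∑ i ∈ Φ, r i = Φ.card - p ⟨0, hL⟩) ∧
      ∀ l : Fin L, min (p l) (A l).card ≤ ∑ i ∈ A l, (1 - r i) := by
  subst hA0
  obtain ⟨S, hSsub, hScard, hS⟩ :=
    exists_card_eq_forall_subset_or_subset hL A (fun k l h => hchain k l h) hp1
  refine ⟨fun i => if i ∈ S then 0 else 1, fun i => by dsimp only; split_ifs <;> simp, ?_,
    fun l => ?_⟩
  · rw [← hScard, ← Finset.card_sdiff_of_subset hSsub, Finset.card_eq_sum_ones,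
      Finset.sdiff_eq_filter, Finset.sum_filter]
    exact Finset.sum_congr rfl fun i _ => by by_cases h : i ∈ S <;> simp [h]
  · have hsum : ∑ i ∈ A l, (1 - if i ∈ S then 0 else 1) = (A l ∩ S).card := by
      rw [← Finset.filter_mem_eq_inter, Finset.card_filter]
      exact Finset.sum_congr rfl fun i _ => by by_cases h : i ∈ S <;> simp [h]
    rw [hsum]
    rcases hS l with h | h
    · rw [Finset.inter_eq_left.mpr h]
      exact min_le_right _ _
    · rw [Finset.inter_eq_right.mpr h, hScard]
      exact (min_le_left _ _).trans (hp _ _ (Fin.mk_le_of_le_val (Nat.zero_le _)))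
end

section
/- The function (x,y) ↦ 1/(x⁴y² + 1) is not Lebesgue integrable over the open quadrant {(x,y) ∈ ℝ² : x > 0, y > 0}; equivalently, its Lebesgue integral over that region is +∞. -/
open MeasureTheory

/-- On the rectangle `(0, 1/t] × (0, t²]`, of area `t`, the function `1/(x⁴y² + 1)` is at
least `1/2`. -/
lemma ofReal_half_mul_le_lintegral_quadrant {t : ℝ} (ht : 0 < t) :
    ENNReal.ofReal (1 / 2 * t) ≤ ∫⁻ p in Set.Ioi (0 : ℝ) ×ˢ Set.Ioi (0 : ℝ),
      ENNReal.ofReal (1 / (p.1 ^ 4 * p.2 ^ 2 + 1)) := by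
  have hR : MeasurableSet (Set.Ioc (0 : ℝ) t⁻¹ ×ˢ Set.Ioc (0 : ℝ) (t ^ 2)) :=
    measurableSet_Ioc.prod measurableSet_Ioc
  calc ENNReal.ofReal (1 / 2 * t)
      = ∫⁻ _ in Set.Ioc (0 : ℝ) t⁻¹ ×ˢ Set.Ioc (0 : ℝ) (t ^ 2), ENNReal.ofReal (1 / 2) := by
        rw [setLIntegral_const, Measure.volume_eq_prod, Measure.prod_prod, Real.volume_Ioc,
          Real.volume_Ioc, ← ENNReal.ofReal_mul (by simpa using ht.le),
          ← ENNReal.ofReal_mul (by norm_num)]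
        congr 1
        field_simp
        ring
    _ ≤ ∫⁻ p in Set.Ioc (0 : ℝ) t⁻¹ ×ˢ Set.Ioc (0 : ℝ) (t ^ 2),
          ENNReal.ofReal (1 / (p.1 ^ 4 * p.2 ^ 2 + 1)) := by
        refine setLIntegral_mono' hR fun p hp => ENNReal.ofReal_le_ofReal ?_
        obtain ⟨⟨hx, hxt⟩, hy, hyt⟩ := hp
        have h : p.1 ^ 4 * p.2 ^ 2 ≤ (t⁻¹) ^ 4 * (t ^ 2) ^ 2 := by gcongr
        have h' : (t⁻¹) ^ 4 * (t ^ 2) ^ 2 = 1 := by field_simp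
        exact one_div_le_one_div_of_le (by positivity) (by linarith)
    _ ≤ _ := lintegral_mono_set (Set.prod_mono Set.Ioc_subset_Ioi_self Set.Ioc_subset_Ioi_self)

/-- `(x,y) ↦ 1/(x⁴y² + 1)` is not Lebesgue integrable on the open
quadrant `{x > 0, y > 0}`; equivalently its Lebesgue integral there is `+∞`. -/
theorem stmt_6 :
    ¬ IntegrableOn (fun p : ℝ × ℝ => 1 / (p.1 ^ 4 * p.2 ^ 2 + 1))
        (Set.Ioi 0 ×ˢ Set.Ioi 0)
    ∧ ∫⁻ p in Set.Ioi (0 : ℝ) ×ˢ Set.Ioi (0 : ℝ),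
        ENNReal.ofReal (1 / (p.1 ^ 4 * p.2 ^ 2 + 1)) = ⊤ := by
  have h : ∫⁻ p in Set.Ioi (0 : ℝ) ×ˢ Set.Ioi (0 : ℝ),
      ENNReal.ofReal (1 / (p.1 ^ 4 * p.2 ^ 2 + 1)) = ⊤ := by
    refine ENNReal.eq_top_of_forall_nnreal_le fun r => ?_
    rw [← ENNReal.ofReal_coe_nnreal]
    exact (ENNReal.ofReal_le_ofReal (by linarith)).trans
      (ofReal_half_mul_le_lintegral_quadrant (t := 2 * (r + 1)) (by positivity))
  refine ⟨fun hi => ?_, h⟩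
  exact hi.lintegral_lt_top.ne h
end

section
/- The function λ ↦ f(λ, 1/λ), where f(λ,Λ) = ∫_{λ}^{Λ}∫_{λ}^{Λ} dx dy/(x⁴y² + 1), tends to +∞ as λ → 0⁺. -/
open MeasureTheory

/-- The integrand `1 / (x⁴y² + 1)` is jointly continuous. -/
lemma continuous_integrand :
    Continuous (fun p : ℝ × ℝ => 1 / (p.1 ^ 4 * p.2 ^ 2 + 1)) := by
  refine continuous_const.div (by fun_prop) fun p => ?_
  positivity

/-- Lower bound for the inner integral when `x ≤ √L`: there the integrand is at least `1 / 2`. -/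
lemma half_le_inner_integral {L x : ℝ} (hL : 0 < L) (hL1 : L ≤ 1) (hx : 0 ≤ x)
    (hxL : x ≤ √L) :
    (1 / L - L) * (1 / 2) ≤ ∫ y in L..(1 / L), 1 / (x ^ 4 * y ^ 2 + 1) := by
  have hle : L ≤ 1 / L := by
    rw [le_div_iff₀ hL]
    nlinarith
  rw [← smul_eq_mul, ← intervalIntegral.integral_const]
  refine intervalIntegral.integral_mono_on hle (by simp) ?_ fun y hy => ?_
  · exact (continuous_integrand.comp (Continuous.prodMk_right x)).intervalIntegrable _ _
  · have hy0 : 0 ≤ y := hL.le.trans hy.1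
    have hx2 : x ^ 2 ≤ L := by
      rw [← Real.sq_sqrt hL.le]
      gcongr
    have hxy : x ^ 2 * y ≤ 1 := by
      calc x ^ 2 * y ≤ L * (1 / L) := by
            gcongr
            exact hy.2
        _ = 1 := by field_simp
    have hsq : (x ^ 2 * y) ^ 2 ≤ 1 := pow_le_one₀ (by positivity) hxy
    apply one_div_le_one_div_of_le (by positivity)
    linarith [show x ^ 4 * y ^ 2 = (x ^ 2 * y) ^ 2 by ring]

/-- For `0 < L ≤ 1 / 4` the double integral over `[L, 1 / L]²` is at least `(√L)⁻¹ / 8`. -/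
lemma inv_sqrt_le_double_integral {L : ℝ} (hL : 0 < L) (hL4 : L ≤ 1 / 4) :
    (√L)⁻¹ / 8 ≤
      ∫ x in L..(1 / L), ∫ y in L..(1 / L), 1 / (x ^ 4 * y ^ 2 + 1) := by
  have hs : 0 < √L := Real.sqrt_pos.2 hL
  have hsq : √L ^ 2 = L := Real.sq_sqrt hL.le
  have hs2 : √L ≤ 1 / 2 := by nlinarith
  have hLs : L ≤ √L := by nlinarith
  have hsL : √L ≤ 1 / L := by
    rw [le_div_iff₀ hL]
    nlinarith
  have hLL : L ≤ 1 / L := hLs.trans hsL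
  have hcont : Continuous fun x : ℝ => ∫ y in L..(1 / L), 1 / (x ^ 4 * y ^ 2 + 1) :=
    intervalIntegral.continuous_parametric_intervalIntegral_of_continuous'
      continuous_integrand _ _
  calc (√L)⁻¹ / 8 ≤ (√L - L) * ((1 / L - L) * (1 / 2)) := by
        have h1 : √L / 2 ≤ √L - L := by nlinarith
        have h2 : 1 / L / 2 ≤ 1 / L - L := by
          have : 2 * L ≤ 1 / L := by
            rw [le_div_iff₀ hL]
            nlinarith
          linarith
        calc (√L)⁻¹ / 8 = √L / 2 * (1 / √L ^ 2 / 2 * (1 / 2)) := by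
              field_simp
              norm_num
          _ = √L / 2 * (1 / L / 2 * (1 / 2)) := by rw [hsq]
          _ ≤ _ := by gcongr
    _ = ∫ _ in L..√L, (1 / L - L) * (1 / 2) := by
        rw [intervalIntegral.integral_const, smul_eq_mul]
    _ ≤ ∫ x in L..√L, ∫ y in L..(1 / L), 1 / (x ^ 4 * y ^ 2 + 1) :=
        intervalIntegral.integral_mono_on hLs (by simp) (hcont.intervalIntegrable _ _)
          fun x hx => half_le_inner_integral hL (by linarith) (hL.le.trans hx.1) hx.2
    _ ≤ _ := by
        refine intervalIntegral.integral_mono_interval le_rfl hLs hsL ?_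
          (hcont.intervalIntegrable _ _)
        refine Filter.Eventually.of_forall fun x => ?_
        exact intervalIntegral.integral_nonneg hLL fun y _ => by positivity

/-- `f(λ, 1/λ) = ∫_λ^{1/λ} ∫_λ^{1/λ} dx dy/(x⁴y²+1)` tends to `+∞`
as `λ → 0⁺`. -/
theorem stmt_9 :
    Filter.Tendsto
      (fun lam : ℝ =>
        ∫ x in lam..(1 / lam), ∫ y in lam..(1 / lam), 1 / (x ^ 4 * y ^ 2 + 1))
      (nhdsWithin 0 (Set.Ioi 0)) Filter.atTop := by
  have hsqrt : Filter.Tendsto Real.sqrt (nhdsWithin 0 (Set.Ioi 0))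
      (nhdsWithin 0 (Set.Ioi 0)) := by
    refine tendsto_nhdsWithin_iff.2 ⟨?_, ?_⟩
    · simpa using (Real.continuous_sqrt.tendsto 0).mono_left nhdsWithin_le_nhds
    · filter_upwards [self_mem_nhdsWithin] with L hL using Real.sqrt_pos.2 hL
  refine Filter.tendsto_atTop_mono' _ ?_
    ((tendsto_inv_nhdsGT_zero.comp hsqrt).atTop_div_const (by norm_num : (0 : ℝ) < 8))
  filter_upwards [Ioc_mem_nhdsGT (by norm_num : (0 : ℝ) < 1 / 4)] with L hL
  exact inv_sqrt_le_double_integral hL.1 hL.2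
end

section
/- Let L ≥ 2 be an integer. The function g : ℝ^{L−1} → ℝ given by g(z_1,…,z_{L−1}) = ( min(z_1,…,z_{L−1}, 1 − z_1 − … − z_{L−1}) )^{1/2} / ( z_1 · z_2 ⋯ z_{L−1} · (1 − z_1 − … − z_{L−1}) ) is Lebesgue integrable on the open simplex {(z_1,…,z_{L−1}) : z_i > 0 for all i, z_1 + … + z_{L−1} < 1}. Consequently, any measurable function I′ on the simplex satisfying |I′(z)| ≤ C · (min(z_1,…,z_L))^{1/2}/(z_1⋯z_L) with z_L = 1 − z_1 − … − z_{L−1} is integrable over the simplex. -/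
open MeasureTheory

section Simplex

variable {ι : Type*} [Fintype ι]

/-- The open simplex `{z_i > 0, Σ z_i < 1}`. -/
def openSimplex (ι : Type*) [Fintype ι] : Set (ι → ℝ) :=
  {z | (∀ i, 0 < z i) ∧ ∑ i, z i < 1}

lemma measurableSet_openSimplex : MeasurableSet (openSimplex ι) := by
  have h : openSimplex ι = (⋂ i, {z : ι → ℝ | 0 < z i}) ∩ {z | ∑ i, z i < 1} := by
    ext z; simp [openSimplex]
  rw [h]
  exact (MeasurableSet.iInter fun i => measurableSet_lt measurable_const (measurable_pi_apply i)).inter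
    (measurableSet_lt (by fun_prop) measurable_const)

lemma lt_one_of_mem_openSimplex {z : ι → ℝ} (hz : z ∈ openSimplex ι) (i : ι) : z i < 1 :=
  (Finset.single_le_sum (fun j _ => (hz.1 j).le) (Finset.mem_univ i)).trans_lt hz.2

/-- The product of `f` over all barycentric coordinates of `z`, the last one being `1 - Σ z_i`. -/
def barycentricProd (f : ℝ → ℝ) (z : ι → ℝ) : ℝ :=
  f (1 - ∑ i, z i) * ∏ i, f (z i)

/-- Near the vertex where the last barycentric coordinate is `1`, products of powers `> -1` of the
barycentric coordinates are integrable. -/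
lemma integrableOn_barycentricProd_rpow_of_le {a c : ℝ} (ha : -1 < a) (ha' : a ≤ 0) (hc : 0 < c) :
    IntegrableOn (barycentricProd (· ^ a)) (openSimplex ι ∩ {z : ι → ℝ | c ≤ 1 - ∑ i, z i}) := by
  have hcube : IntegrableOn (fun z : ι → ℝ => c ^ a * ∏ i, z i ^ a)
      (Set.univ.pi fun _ => Set.Ioo 0 1) := by
    refine Integrable.const_mul ?_ _
    rw [volume_pi, Measure.restrict_pi_pi]
    exact Integrable.fintype_prod (f := fun _ x => x ^ a) fun _ =>
      (intervalIntegral.integrableOn_Ioo_rpow_iff zero_lt_one).2 ha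
  have hmeas : MeasurableSet (openSimplex ι ∩ {z : ι → ℝ | c ≤ 1 - ∑ i, z i}) :=
    measurableSet_openSimplex.inter (measurableSet_le measurable_const (by fun_prop))
  refine Integrable.mono' (hcube.mono_set fun z hz i _ =>
    ⟨hz.1.1 i, lt_one_of_mem_openSimplex hz.1 i⟩) ?_ ?_
  · unfold barycentricProd
    exact Measurable.aestronglyMeasurable (by fun_prop)
  · refine ae_restrict_of_forall_mem hmeas fun z hz => ?_
    have hprod : 0 ≤ ∏ i, z i ^ a := Finset.prod_nonneg fun i _ => Real.rpow_nonneg (hz.1.1 i).le _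
    have hw : 0 ≤ 1 - ∑ i, z i := hc.le.trans hz.2
    rw [barycentricProd, Real.norm_of_nonneg (mul_nonneg (Real.rpow_nonneg hw _) hprod)]
    exact mul_le_mul_of_nonneg_right (Real.rpow_le_rpow_of_nonpos hc hz.2 ha') hprod

lemma sqrt_min_div_le_barycentricProd_rpow [Nonempty ι] {z : ι → ℝ} (hz : z ∈ openSimplex ι) :
    Real.sqrt (min (⨅ i, z i) (1 - ∑ i, z i)) / ((∏ i, z i) * (1 - ∑ i, z i))
      ≤ barycentricProd (· ^ (1 / (2 * (Fintype.card ι + 1 : ℝ)) - 1)) z := by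
  have hw : 0 < 1 - ∑ i, z i := sub_pos.2 hz.2
  have hp : 0 < ∏ i, z i := Finset.prod_pos fun i _ => hz.1 i
  set m := min (⨅ i, z i) (1 - ∑ i, z i) with hm
  have hm0 : 0 ≤ m := le_min (le_ciInf fun i => (hz.1 i).le) hw.le
  have hmz (i : ι) : m ≤ z i :=
    (min_le_left _ _).trans (ciInf_le (Set.finite_range _).bddBelow i)
  have hpow : m ^ (Fintype.card ι + 1) ≤ (∏ i, z i) * (1 - ∑ i, z i) := by
    rw [pow_succ]
    refine mul_le_mul ?_ (min_le_right _ _) hm0 hp.le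
    simpa using Finset.prod_le_prod (fun _ _ => hm0) fun i (_ : i ∈ Finset.univ) => hmz i
  have hsqrt : Real.sqrt m
      ≤ ((∏ i, z i) * (1 - ∑ i, z i)) ^ (1 / (2 * (Fintype.card ι + 1 : ℝ))) := by
    refine le_trans (le_of_eq ?_) (Real.rpow_le_rpow (pow_nonneg hm0 _) hpow (by positivity))
    rw [Real.sqrt_eq_rpow, ← Real.rpow_natCast, ← Real.rpow_mul hm0]
    congr 1
    push_cast
    field_simp
  have hbary (a : ℝ) : barycentricProd (· ^ a) z = ((∏ i, z i) * (1 - ∑ i, z i)) ^ a := by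
    rw [barycentricProd, Real.mul_rpow hp.le hw.le,
      Real.finsetProd_rpow _ _ (fun i _ => (hz.1 i).le), mul_comm]
  rw [hbary, Real.rpow_sub_one (mul_pos hp hw).ne']
  exact div_le_div_of_nonneg_right hsqrt (mul_pos hp hw).le

variable [DecidableEq ι]

/-- The linear involution replacing the coordinate `j` by minus the sum of all coordinates. -/
def swapSumLinear (j : ι) : (ι → ℝ) →ₗ[ℝ] (ι → ℝ) where
  toFun z := Function.update z j (-∑ i, z i)
  map_add' x y := by
    ext i
    by_cases h : i = j
    · subst h; simp [Finset.sum_add_distrib]; ring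
    · simp [h]
  map_smul' r x := by
    ext i
    by_cases h : i = j
    · subst h; simp [Finset.mul_sum]
    · simp [h]

/-- The affine involution exchanging the barycentric coordinates `z j` and `1 - Σ z_i`. -/
def swapLast (j : ι) (z : ι → ℝ) : ι → ℝ :=
  Function.update z j (1 - ∑ i, z i)

lemma sum_update_eq (z : ι → ℝ) (j : ι) (x : ℝ) :
    ∑ i, Function.update z j x i = x + (∑ i, z i - z j) := by
  rw [Finset.sum_update_of_mem (Finset.mem_univ j), ← Finset.erase_eq,
    ← Finset.add_sum_erase _ _ (Finset.mem_univ j)]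
  ring

lemma one_sub_sum_swapLast (j : ι) (z : ι → ℝ) : 1 - ∑ i, swapLast j z i = z j := by
  rw [swapLast, sum_update_eq]; ring

lemma swapLast_swapLast (j : ι) (z : ι → ℝ) : swapLast j (swapLast j z) = z := by
  conv_lhs => rw [swapLast, one_sub_sum_swapLast]
  simp [swapLast]

lemma measurable_swapLast (j : ι) : Measurable (swapLast j) := by
  refine measurable_pi_lambda _ fun i => ?_
  by_cases h : i = j
  · subst h; simp only [swapLast, Function.update_self]; fun_prop
  · simp only [swapLast, Function.update_of_ne h]; fun_prop

lemma abs_det_swapSumLinear (j : ι) : |LinearMap.det (swapSumLinear j)| = 1 := by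
  have h : swapSumLinear j ∘ₗ swapSumLinear j = LinearMap.id := by
    refine LinearMap.ext fun z => ?_
    simp [swapSumLinear, sum_update_eq]
  have h' := congrArg LinearMap.det h
  rw [LinearMap.det_comp, LinearMap.det_id, ← pow_two] at h'
  exact (pow_eq_one_iff_of_nonneg (abs_nonneg _) two_ne_zero).1 (by rw [sq_abs, h'])

lemma measurePreserving_swapLast (j : ι) :
    MeasurePreserving (swapLast j) (volume : Measure (ι → ℝ)) volume := by
  have hlin : MeasurePreserving (swapSumLinear j) (volume : Measure (ι → ℝ)) volume := by
    refine ⟨(swapSumLinear j).continuous_of_finiteDimensional.measurable, ?_⟩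
    have hdet := abs_det_swapSumLinear j
    rw [Real.map_linearMap_volume_pi_eq_smul_volume_pi, abs_inv, hdet]
    · simp
    · intro h; simp [h] at hdet
  have heq : swapLast j = (Pi.single j (1 : ℝ) + ·) ∘ swapSumLinear j := by
    ext z i
    by_cases h : i = j
    · subst h; simp [swapLast, swapSumLinear, sub_eq_add_neg]
    · simp [swapLast, swapSumLinear, h]
  rw [heq]
  exact (measurePreserving_add_left volume _).comp hlin

lemma barycentricProd_swapLast (f : ℝ → ℝ) (j : ι) (z : ι → ℝ) :
    barycentricProd f (swapLast j z) = barycentricProd f z := by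
  rw [barycentricProd, barycentricProd, one_sub_sum_swapLast,
    ← Finset.mul_prod_erase _ _ (Finset.mem_univ j),
    ← Finset.mul_prod_erase _ (fun i => f (z i)) (Finset.mem_univ j),
    Finset.prod_congr rfl fun i hi => by
      rw [swapLast, Function.update_of_ne (Finset.ne_of_mem_erase hi)]]
  simp only [swapLast, Function.update_self]
  ring

lemma swapLast_mem_openSimplex {j : ι} {z : ι → ℝ} (hz : z ∈ openSimplex ι) :
    swapLast j z ∈ openSimplex ι := by
  refine ⟨fun i => ?_, ?_⟩
  · by_cases h : i = j
    · subst h; simpa [swapLast] using hz.2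
    · simpa [swapLast, h] using hz.1 i
  · linarith [one_sub_sum_swapLast j z, hz.1 j]

lemma integrableOn_barycentricProd_rpow_of_le_apply {a c : ℝ} (ha : -1 < a) (ha' : a ≤ 0)
    (hc : 0 < c) (j : ι) :
    IntegrableOn (barycentricProd (· ^ a)) (openSimplex ι ∩ {z : ι → ℝ | c ≤ z j}) := by
  have hemb : MeasurableEmbedding (swapLast j) :=
    (MeasurableEquiv.mk ⟨swapLast j, swapLast j, swapLast_swapLast j, swapLast_swapLast j⟩
      (measurable_swapLast j) (measurable_swapLast j)).measurableEmbedding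
  have h := ((measurePreserving_swapLast j).integrableOn_comp_preimage hemb).2
    (integrableOn_barycentricProd_rpow_of_le (ι := ι) ha ha' hc)
  rw [show barycentricProd (· ^ a) ∘ swapLast j = barycentricProd (· ^ a) from
    funext (barycentricProd_swapLast _ j)] at h
  refine h.mono_set fun z hz => ⟨swapLast_mem_openSimplex hz.1, ?_⟩
  rw [Set.mem_ofPred_eq, one_sub_sum_swapLast]
  exact hz.2

/-- The Dirichlet density with equal exponents is integrable on the simplex. -/
theorem integrableOn_barycentricProd_rpow {a : ℝ} (ha : -1 < a) (ha' : a ≤ 0) :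
    IntegrableOn (barycentricProd (· ^ a)) (openSimplex ι) := by
  have hc : (0 : ℝ) < 1 / (Fintype.card ι + 1) := by positivity
  refine ((integrableOn_barycentricProd_rpow_of_le ha ha' hc).union
    (integrableOn_finite_iUnion.2
      (integrableOn_barycentricProd_rpow_of_le_apply ha ha' hc))).mono_set fun z hz => ?_
  by_contra hcon
  simp only [Set.mem_union, Set.mem_inter_iff, Set.mem_iUnion, Set.mem_ofPred_eq, hz, true_and,
    not_or, not_exists, not_le] at hcon
  have hsum := Finset.sum_le_sum fun i (_ : i ∈ Finset.univ) => (hcon.2 i).le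
  have hone : (Fintype.card ι + 1 : ℝ) * (1 / (Fintype.card ι + 1)) = 1 := by field_simp
  rw [Finset.sum_const, Finset.card_univ, nsmul_eq_mul] at hsum
  linarith [hcon.1]

theorem integrableOn_sqrt_min_div [Nonempty ι] :
    IntegrableOn (fun z : ι → ℝ => Real.sqrt (min (⨅ i, z i) (1 - ∑ i, z i))
      / ((∏ i, z i) * (1 - ∑ i, z i))) (openSimplex ι) := by
  have hexp : 1 / (2 * (Fintype.card ι + 1 : ℝ)) ≤ 1 := by
    rw [div_le_one (by positivity)]
    linarith [Nat.cast_nonneg (α := ℝ) (Fintype.card ι)]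
  have hexp' : 0 < 1 / (2 * (Fintype.card ι + 1 : ℝ)) := by positivity
  refine Integrable.mono' (integrableOn_barycentricProd_rpow
    (a := 1 / (2 * (Fintype.card ι + 1 : ℝ)) - 1) (by linarith) (by linarith)) ?_ ?_
  · have : Measurable fun z : ι → ℝ => ⨅ i, z i := Measurable.iInf fun i => measurable_pi_apply i
    exact Measurable.aestronglyMeasurable (by fun_prop)
  · refine ae_restrict_of_forall_mem measurableSet_openSimplex fun z hz => ?_
    rw [Real.norm_of_nonneg (div_nonneg (Real.sqrt_nonneg _)
      (mul_nonneg (Finset.prod_nonneg fun i _ => (hz.1 i).le) (sub_pos.2 hz.2).le))]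
    exact sqrt_min_div_le_barycentricProd_rpow hz

end Simplex

open MeasureTheory

/-- for `L ≥ 2`, the function
`g(z) = √(min(z_1,…,z_{L−1}, 1−Σz)) / (z_1⋯z_{L−1}·(1−Σz))` is Lebesgue integrable
on the open simplex `{z_i > 0, Σ z_i < 1}` of `ℝ^{L−1}`; consequently any
measurable `I'` with `|I'(z)| ≤ C · √(min(z_1,…,z_L)) / (z_1⋯z_L)` (where
`z_L = 1 − z_1 − … − z_{L−1}`) is integrable over the simplex. -/
theorem stmt_11 (L : ℕ) (hL : 2 ≤ L) :
    IntegrableOn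
      (fun z : Fin (L - 1) → ℝ =>
        Real.sqrt (min (⨅ i, z i) (1 - ∑ i, z i))
          / ((∏ i, z i) * (1 - ∑ i, z i)))
      {z : Fin (L - 1) → ℝ | (∀ i, 0 < z i) ∧ ∑ i, z i < 1}
    ∧ ∀ (I' : (Fin (L - 1) → ℝ) → ℝ) (C : ℝ), Measurable I' →
        (∀ z ∈ {z : Fin (L - 1) → ℝ | (∀ i, 0 < z i) ∧ ∑ i, z i < 1},
          |I' z| ≤ C * Real.sqrt (min (⨅ i, z i) (1 - ∑ i, z i))
            / ((∏ i, z i) * (1 - ∑ i, z i))) →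
        IntegrableOn I' {z : Fin (L - 1) → ℝ | (∀ i, 0 < z i) ∧ ∑ i, z i < 1} := by
  have : Nonempty (Fin (L - 1)) := ⟨⟨0, by omega⟩⟩
  have hg := integrableOn_sqrt_min_div (ι := Fin (L - 1))
  refine ⟨hg, fun I' C hI' hle => ?_⟩
  refine Integrable.mono' (hg.const_mul C) hI'.aestronglyMeasurable
    (ae_restrict_of_forall_mem measurableSet_openSimplex fun z hz => ?_)
  rw [Real.norm_eq_abs, ← mul_div_assoc]
  exact hle z hz
end

section
/- Let L ≥ 1 be an integer, ε > 0, and d_1,…,d_L real numbers with d_l > 0 for all l. For z ∈ (0,∞)^L, let j_1,…,j_L be a permutation with z_{j_1} ≥ … ≥ z_{j_L}, and set t_1 = z_{j_1}, t_l = z_{j_l}/z_{j_{l−1}} for 2 ≤ l ≤ L. Then the function z ↦ e^{−ε·max(z_1,…,z_L)} · (t_1^{d_1} t_2^{d_2} ⋯ t_L^{d_L}) / (z_1 z_2 ⋯ z_L) is Lebesgue integrable on (0,∞)^L. -/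
open MeasureTheory

theorem rpow_le_mul_exp {a b x : ℝ} (ha : 0 < a) (hb : 0 < b) (hx : 0 ≤ x) :
    x ^ a ≤ (a / b) ^ a * Real.exp (b * x) := by
  have hle : x ≤ a / b * Real.exp (b * x / a) := by
    have h := Real.add_one_le_exp (b * x / a)
    calc x = a / b * (b * x / a) := by field_simp
      _ ≤ a / b * Real.exp (b * x / a) := by gcongr; linarith
  calc x ^ a ≤ (a / b * Real.exp (b * x / a)) ^ a := by gcongr
    _ = (a / b) ^ a * Real.exp (b * x) := by
      rw [Real.mul_rpow (by positivity) (by positivity), ← Real.exp_mul]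
      congr 2
      field_simp

theorem prod_succ_div_castSucc : ∀ {n : ℕ} (f : Fin (n + 1) → ℝ), (∀ i, 0 < f i) →
    ∏ i : Fin n, f i.succ / f i.castSucc = f (Fin.last n) / f 0
  | 0, f, hf => by simp [(hf 0).ne']
  | n + 1, f, hf => by
    have ih := prod_succ_div_castSucc (fun i : Fin (n + 1) => f i.castSucc) fun i => hf _
    have h := (hf (Fin.last n).castSucc).ne'
    have h0 := (hf 0).ne'
    rw [Fin.prod_univ_castSucc]
    simp only [Fin.castSucc_zero, Fin.succ_last, Fin.succ_castSucc] at ih ⊢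
    rw [ih]
    field_simp

theorem integrableOn_prod_rpow_mul_exp {ι : Type*} [Fintype ι] {s b : ℝ} (hs : -1 < s)
    (hb : 0 < b) :
    IntegrableOn (fun z : ι → ℝ => ∏ i, z i ^ s * Real.exp (-b * z i)) {z | ∀ i, 0 < z i} := by
  have hset : {z : ι → ℝ | ∀ i, 0 < z i} = Set.univ.pi fun _ => Set.Ioi 0 := by
    ext; simp
  have h := integrableOn_rpow_mul_exp_neg_mul_rpow hs one_pos hb
  simp only [Real.rpow_one] at h
  rw [hset, IntegrableOn, volume_pi, Measure.restrict_pi_pi]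
  exact Integrable.fintype_prod fun _ => h

theorem measurable_apply_antitone_perm {n : ℕ} {j : (Fin n → ℝ) → Equiv.Perm (Fin n)}
    (hj : ∀ z : Fin n → ℝ, Antitone (z ∘ j z)) (l : Fin n) :
    Measurable fun z : Fin n → ℝ => z (j z l) := by
  refine measurable_of_Ioi fun a => ?_
  have hset : (fun z : Fin n → ℝ => z (j z l)) ⁻¹' Set.Ioi a =
      ⋃ σ : Equiv.Perm (Fin n),
        {z | ∀ k m, k ≤ m → z (σ m) ≤ z (σ k)} ∩ {z | a < z (σ l)} := by
    ext z
    simp only [Set.mem_preimage, Set.mem_Ioi, Set.mem_iUnion, Set.mem_inter_iff,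
      Set.mem_ofPred_eq]
    refine ⟨fun h => ⟨j z, fun k m hkm => hj z hkm, h⟩, ?_⟩
    rintro ⟨σ, hσ, h⟩
    have heq := congrFun (Tuple.unique_antitone (hj z) (τ := σ) fun k m hkm => hσ k m hkm) l
    simp only [Function.comp_apply] at heq
    rwa [heq]
  rw [hset]
  refine MeasurableSet.iUnion fun σ => MeasurableSet.inter ?_ ?_
  · simp only [Set.ofPred_forall]
    exact MeasurableSet.iInter fun k => MeasurableSet.iInter fun m =>
      MeasurableSet.iInter fun _ => measurableSet_le (by fun_prop) (by fun_prop)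
  · exact measurableSet_lt (by fun_prop) (by fun_prop)

theorem prod_sector_rpow_le {n : ℕ} {y d : Fin (n + 1) → ℝ} (hy : ∀ i, 0 < y i)
    (hanti : Antitone y) {δ : ℝ} (hδ : 0 < δ) (hd : ∀ i, δ ≤ d i) :
    y 0 ^ d 0 * ∏ i : Fin n, (y i.succ / y i.castSucc) ^ d i.succ ≤
      y 0 ^ (d 0 - δ) * ∏ i, y i ^ (δ / (n + 1)) := by
  have hlast := hy (Fin.last n)
  have h0 := hy 0
  have hratio : ∏ i : Fin n, (y i.succ / y i.castSucc) ^ d i.succ ≤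
      (y (Fin.last n) / y 0) ^ δ := by
    rw [← prod_succ_div_castSucc y hy, ← Real.finsetProd_rpow _ _
      fun i _ => (div_pos (hy _) (hy _)).le]
    refine Finset.prod_le_prod (fun i _ => Real.rpow_nonneg (div_pos (hy _) (hy _)).le _)
      fun i _ => ?_
    exact Real.rpow_le_rpow_of_exponent_ge (div_pos (hy _) (hy _))
      ((div_le_one (hy _)).2 (hanti i.castSucc_lt_succ.le)) (hd _)
  have hmin : y (Fin.last n) ^ δ ≤ ∏ i, y i ^ (δ / (n + 1)) := by
    calc y (Fin.last n) ^ δ = ∏ _i : Fin (n + 1), y (Fin.last n) ^ (δ / (n + 1)) := by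
          rw [Finset.prod_const, Finset.card_univ, Fintype.card_fin, ← Real.rpow_mul_natCast hlast.le]
          congr 1
          push_cast
          field_simp
      _ ≤ _ := Finset.prod_le_prod (fun i _ => by positivity) fun i _ =>
          Real.rpow_le_rpow hlast.le (hanti (Fin.le_last i)) (by positivity)
  calc _ ≤ y 0 ^ d 0 * (y (Fin.last n) / y 0) ^ δ := by gcongr
    _ = y 0 ^ (d 0 - δ) * y (Fin.last n) ^ δ := by
      rw [Real.div_rpow hlast.le h0.le, Real.rpow_sub h0]
      ring
    _ ≤ _ := by gcongr

theorem exp_neg_mul_le_prod {n : ℕ} {y : Fin (n + 1) → ℝ} (hanti : Antitone y) {b : ℝ}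
    (hb : 0 < b) : Real.exp (-b * y 0) ≤ ∏ i, Real.exp (-(b / (n + 1)) * y i) := by
  calc Real.exp (-b * y 0) = ∏ _i : Fin (n + 1), Real.exp (-(b / (n + 1)) * y 0) := by
        rw [Finset.prod_const, Finset.card_univ, Fintype.card_fin, ← Real.exp_nat_mul]
        congr 1
        push_cast
        field_simp
    _ ≤ _ := Finset.prod_le_prod (fun i _ => by positivity) fun i _ => by
        have h : b / (n + 1) * y i ≤ b / (n + 1) * y 0 := by
          gcongr
          exact hanti (Fin.zero_le i)
        exact Real.exp_le_exp.2 (by linarith)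

theorem sector_integrand_le {n : ℕ} {y d : Fin (n + 1) → ℝ} (hy : ∀ i, 0 < y i)
    (hanti : Antitone y) {δ ε : ℝ} (hδ : 0 < δ) (hd : ∀ i, δ < d i) (hε : 0 < ε) :
    Real.exp (-ε * y 0) *
        (y 0 ^ d 0 * ∏ i : Fin n, (y i.succ / y i.castSucc) ^ d i.succ) / ∏ i, y i ≤
      ((d 0 - δ) / (ε / 2)) ^ (d 0 - δ) *
        ∏ i, y i ^ (δ / (n + 1) - 1) * Real.exp (-(ε / 2 / (n + 1)) * y i) := by
  have ha : 0 < d 0 - δ := sub_pos.2 (hd 0)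
  have hpow := rpow_le_mul_exp ha (half_pos hε) (hy 0).le
  have hprod : 0 < ∏ i, y i := Finset.prod_pos fun i _ => hy i
  have hR : 0 ≤ ∏ i, y i ^ (δ / (n + 1)) :=
    Finset.prod_nonneg fun i _ => Real.rpow_nonneg (hy i).le _
  have hsplit : Real.exp (-ε * y 0) * Real.exp (ε / 2 * y 0) = Real.exp (-(ε / 2) * y 0) := by
    rw [← Real.exp_add]
    ring_nf
  have hC : 0 ≤ ((d 0 - δ) / (ε / 2)) ^ (d 0 - δ) := by positivity
  have hrhs : ∏ i, y i ^ (δ / (n + 1) - 1) * Real.exp (-(ε / 2 / (n + 1)) * y i) =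
      (∏ i, y i ^ (δ / (n + 1))) * (∏ i, Real.exp (-(ε / 2 / (n + 1)) * y i)) / ∏ i, y i := by
    rw [← Finset.prod_mul_distrib, ← Finset.prod_div_distrib]
    refine Finset.prod_congr rfl fun i _ => ?_
    rw [Real.rpow_sub_one (hy i).ne']
    ring
  rw [hrhs, ← mul_div_assoc]
  refine div_le_div_of_nonneg_right ?_ hprod.le
  calc _ ≤ Real.exp (-ε * y 0) * (y 0 ^ (d 0 - δ) * ∏ i, y i ^ (δ / (n + 1))) := by
        exact mul_le_mul_of_nonneg_left (prod_sector_rpow_le hy hanti hδ fun i => (hd i).le)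
          (Real.exp_nonneg _)
    _ ≤ Real.exp (-ε * y 0) * (((d 0 - δ) / (ε / 2)) ^ (d 0 - δ) * Real.exp (ε / 2 * y 0) *
          ∏ i, y i ^ (δ / (n + 1))) := by gcongr
    _ = ((d 0 - δ) / (ε / 2)) ^ (d 0 - δ) *
          ((∏ i, y i ^ (δ / (n + 1))) * Real.exp (-(ε / 2) * y 0)) := by
        rw [← hsplit]
        ring
    _ ≤ _ := by
        gcongr
        exact exp_neg_mul_le_prod hanti (half_pos hε)

/-- for `ε > 0` and real exponents `d_l > 0`, the function
`z ↦ e^{−ε·max(z_1,…,z_L)} · (t_1^{d_1}⋯t_L^{d_L}) / (z_1⋯z_L)`, where `t` are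
the Hepp sector variables for the decreasing ordering `j` of `z`, is Lebesgue
integrable on `(0,∞)^L`. -/
theorem stmt_12 (L : ℕ) (hL : 1 ≤ L) (ε : ℝ) (hε : 0 < ε)
    (d : Fin L → ℝ) (hd : ∀ l, 0 < d l)
    (j : (Fin L → ℝ) → Equiv.Perm (Fin L))
    (hj : ∀ z : Fin L → ℝ, ∀ k l : Fin L, k ≤ l → z (j z l) ≤ z (j z k))
    (t : (Fin L → ℝ) → Fin L → ℝ)
    (ht : ∀ z : Fin L → ℝ, ∀ l : Fin L, t z l =
      if (l : ℕ) = 0 then z (j z l)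
      else z (j z l) / z (j z ⟨(l : ℕ) - 1, lt_of_le_of_lt (Nat.sub_le _ _) l.isLt⟩)) :
    IntegrableOn
      (fun z : Fin L → ℝ =>
        Real.exp (-ε * ⨆ i, z i) * (∏ l : Fin L, t z l ^ d l) / ∏ i, z i)
      {z : Fin L → ℝ | ∀ i, 0 < z i} := by
  obtain ⟨n, rfl⟩ : ∃ n, L = n + 1 := ⟨L - 1, by omega⟩
  have hanti : ∀ z, Antitone (z ∘ j z) := fun z k l hkl => hj z k l hkl
  have hmeas := measurable_apply_antitone_perm hanti
  obtain ⟨i₀, hi₀⟩ := Finite.exists_min d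
  have hδ : 0 < d i₀ / 2 := half_pos (hd i₀)
  have hδd : ∀ i, d i₀ / 2 < d i := fun i => by linarith [hi₀ i, hd i₀]
  have hsup : ∀ z : Fin (n + 1) → ℝ, ⨆ i, z i = z (j z 0) := fun z => by
    refine le_antisymm (ciSup_le fun i => ?_) (le_ciSup (Set.finite_range z).bddAbove _)
    simpa using hj z 0 ((j z).symm i) (Fin.zero_le _)
  have ht0 : ∀ z, t z 0 = z (j z 0) := fun z => by simp [ht]
  have hts : ∀ z (i : Fin n), t z i.succ = z (j z i.succ) / z (j z i.castSucc) :=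
    fun z i => by
      rw [ht, if_neg (by simp)]
      rfl
  simp only [hsup, Fin.prod_univ_succ (fun l => t _ l ^ d l), ht0, hts]
  have hpos : MeasurableSet {z : Fin (n + 1) → ℝ | ∀ i, 0 < z i} := by
    simp only [Set.ofPred_forall]
    exact MeasurableSet.iInter fun i => measurableSet_lt measurable_const (measurable_pi_apply i)
  have hs : -1 < d i₀ / 2 / ((n : ℝ) + 1) - 1 := by
    have : 0 < d i₀ / 2 / ((n : ℝ) + 1) := by positivity
    linarith
  have hb : 0 < ε / 2 / ((n : ℝ) + 1) := by positivity
  refine Integrable.mono' ((integrableOn_prod_rpow_mul_exp hs hb).const_mul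
    (((d 0 - d i₀ / 2) / (ε / 2)) ^ (d 0 - d i₀ / 2))) ?_ ?_
  · refine Measurable.aestronglyMeasurable ?_
    have hprod : Measurable fun z : Fin (n + 1) → ℝ =>
        ∏ i : Fin n, (z (j z i.succ) / z (j z i.castSucc)) ^ d i.succ :=
      Finset.measurable_fun_prod _ fun i _ => ((hmeas _).div (hmeas _)).pow_const _
    exact (((hmeas 0).const_mul _).exp.mul (((hmeas 0).pow_const _).mul hprod)).div
      (Finset.measurable_fun_prod _ fun i _ => measurable_pi_apply i)
  · filter_upwards [ae_restrict_mem hpos] with z hz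
    have hle := sector_integrand_le (y := z ∘ j z) (fun i => hz _) (hanti z) hδ hδd hε
    rw [Real.norm_of_nonneg]
    · simp only [Function.comp_apply] at hle
      rwa [Equiv.prod_comp (j z) z, Equiv.prod_comp (j z) fun i =>
        z i ^ (d i₀ / 2 / ((n : ℝ) + 1) - 1) * Real.exp (-(ε / 2 / ((n : ℝ) + 1)) * z i)] at hle
    · have h (i) : 0 ≤ z i := (hz i).le
      refine div_nonneg (mul_nonneg (Real.exp_nonneg _) (mul_nonneg (Real.rpow_nonneg (h _) _)
        (Finset.prod_nonneg fun i _ => Real.rpow_nonneg (div_nonneg (h _) (h _)) _)))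
        (Finset.prod_nonneg fun i _ => h i)
end
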